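/- arXiv:1803.03749 — 2 statements merged into one kernel-verified Lean document; each statement's English description precedes it below -/
import Mathlib

section
/- Let aₙ denote the number of spanning trees of the fan graph Θₙ. Then for every n ≥ 2, a_{n+1} = 3·aₙ − a_{n−1}. -/
/-- The number of spanning trees of a graph: the number of subgraphs (on the same
vertex set) that are trees, i.e. connected and acyclic. -/
noncomputable def spanningTreeCount {V : Type*} (G : SimpleGraph V) : ℕ :=
  Nat.card {H : SimpleGraph V // H ≤ G ∧ H.IsTree}

/-- The fan graph `Θₙ` on `n + 1` vertices: the hub is vertex `0`, the path vertices
are `1, …, n` joined consecutively, and the hub is joined to every path vertex. -/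
def fanGraph (n : ℕ) : SimpleGraph (Fin (n + 1)) :=
  SimpleGraph.fromRel (fun i j => i = 0 ∨ (i : ℕ) + 1 = (j : ℕ))

namespace SimpleGraph

variable {V W : Type*}

lemma Connected.of_surjective_of_adj_reachable {G : SimpleGraph V} {H : SimpleGraph W}
    (hG : G.Connected) (g : V → W) (hg : Function.Surjective g)
    (h : ∀ x y, G.Adj x y → H.Reachable (g x) (g y)) : H.Connected := by
  have key (x y : V) : H.Reachable (g x) (g y) := by
    obtain ⟨p⟩ := hG.preconnected x y
    induction p with
    | nil => rfl
    | cons hadj _ ih => exact (h _ _ hadj).trans ih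
  have := hG.nonempty.map g
  refine ⟨fun x y => ?_⟩
  obtain ⟨x, rfl⟩ := hg x
  obtain ⟨y, rfl⟩ := hg y
  exact key x y

lemma ncard_edgeSet_sup_edge [Finite V] (G : SimpleGraph V) {a b : V} (hab : a ≠ b)
    (h : ¬ G.Adj a b) : (G ⊔ edge a b).edgeSet.ncard = G.edgeSet.ncard + 1 := by
  rw [edgeSet_sup, edgeSet_edge_of_ne hab, Set.union_singleton, Set.ncard_insert_of_notMem]
  simpa using h

variable {n : ℕ}

lemma ext_castSucc {K K' : SimpleGraph (Fin (n + 1))}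
    (h : K.comap Fin.castSucc = K'.comap Fin.castSucc)
    (hlast : ∀ x : Fin n, K.Adj x.castSucc (Fin.last n) ↔ K'.Adj x.castSucc (Fin.last n)) :
    K = K' := by
  ext x y
  induction x using Fin.lastCases with
  | last =>
    induction y using Fin.lastCases with
    | last => simp
    | cast y => rw [K.adj_comm, K'.adj_comm, hlast]
  | cast x =>
    induction y using Fin.lastCases with
    | last => exact hlast x
    | cast y => simpa using congrArg (fun G => G.Adj x y) h

lemma exists_comap_castSucc_eq (H : SimpleGraph (Fin n)) (s : Set (Fin n)) :
    ∃ K : SimpleGraph (Fin (n + 1)), K.comap Fin.castSucc = H ∧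
      ∀ x : Fin n, K.Adj x.castSucc (Fin.last n) ↔ x ∈ s := by
  refine ⟨H.map Fin.castSucc ⊔
    fromRel (fun i j => j = Fin.last n ∧ ∃ x ∈ s, x.castSucc = i), ?_, fun x => ?_⟩
  · ext x y
    simp [Fin.castSucc_ne_last, SimpleGraph.map_adj']
    grind [SimpleGraph.Adj.ne]
  · simp [Fin.castSucc_ne_last, SimpleGraph.map_adj']

lemma ncard_edgeSet_eq_comap_castSucc_add (K : SimpleGraph (Fin (n + 1))) :
    K.edgeSet.ncard = (K.comap Fin.castSucc).edgeSet.ncard +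
      {x : Fin n | K.Adj x.castSucc (Fin.last n)}.ncard := by
  have hinj : Function.Injective (fun x : Fin n => s(x.castSucc, Fin.last n)) := by
    intro x y hxy
    simpa [Fin.castSucc_ne_last] using hxy
  have hsplit : K.edgeSet = Sym2.map Fin.castSucc '' (K.comap Fin.castSucc).edgeSet ∪
      (fun x : Fin n => s(x.castSucc, Fin.last n)) ''
        {x : Fin n | K.Adj x.castSucc (Fin.last n)} := by
    ext e
    constructor
    · induction e with | _ x y
      intro h
      induction x using Fin.lastCases with
      | last =>
        induction y using Fin.lastCases with
        | last => simp at h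
        | cast y => exact Or.inr ⟨y, h.symm, Sym2.eq_swap⟩
      | cast x =>
        induction y using Fin.lastCases with
        | last => exact Or.inr ⟨x, h, rfl⟩
        | cast y => exact Or.inl ⟨s(x, y), h, rfl⟩
    · rintro (⟨e, he, rfl⟩ | ⟨x, hx, rfl⟩)
      · induction e with | _ x y
        exact he
      · exact hx
  rw [hsplit, Set.ncard_union_eq, Set.ncard_image_of_injective _ hinj,
    Set.ncard_image_of_injective _ (Sym2.map.injective (Fin.castSucc_injective n))]
  rw [Set.disjoint_left]
  rintro _ ⟨e, he, rfl⟩ ⟨x, hx, h⟩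
  induction e with | _ y z
  simp only [Sym2.map_mk, Sym2.eq_iff] at h
  rcases h with ⟨-, h⟩ | ⟨-, h⟩
  · exact Fin.castSucc_ne_last _ h.symm
  · exact Fin.castSucc_ne_last _ h.symm

/-- Adding a leaf preserves being a tree. -/
lemma isTree_iff_comap_castSucc_of_leaf (K : SimpleGraph (Fin (n + 1))) (a : Fin n)
    (ha : ∀ x : Fin n, K.Adj x.castSucc (Fin.last n) ↔ x = a) :
    K.IsTree ↔ (K.comap Fin.castSucc).IsTree := by
  rw [isTree_iff_connected_and_card, isTree_iff_connected_and_card, Nat.card_coe_set_eq,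
    Nat.card_coe_set_eq, ncard_edgeSet_eq_comap_castSucc_add]
  simp only [ha, Set.ofPred_eq_eq_singleton, Set.ncard_singleton, Nat.card_eq_fintype_card,
    Fintype.card_fin, Nat.add_right_cancel_iff]
  refine and_congr_left fun _ => ⟨fun h => ?_, fun h => ?_⟩
  · refine h.of_surjective_of_adj_reachable (Fin.lastCases a id)
      (fun x => ⟨x.castSucc, by simp⟩) fun x y hxy => ?_
    induction x using Fin.lastCases with
    | last =>
      induction y using Fin.lastCases with
      | last => simp
      | cast y => simp [(ha y).1 hxy.symm]
    | cast x =>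
      induction y using Fin.lastCases with
      | last => simp [(ha x).1 hxy]
      | cast y => simpa using Adj.reachable (G := K.comap Fin.castSucc) hxy
  · have hcast (x y : Fin n) : K.Reachable x.castSucc y.castSucc :=
      (h.preconnected x y).map (Hom.comap Fin.castSucc K)
    have hlast : K.Reachable a.castSucc (Fin.last n) := ((ha a).2 rfl).reachable
    refine (connected_iff_exists_forall_reachable K).2 ⟨a.castSucc, fun x => ?_⟩
    induction x using Fin.lastCases with
    | last => exact hlast
    | cast x => exact hcast a x

/-- Subdividing an edge preserves being a tree. -/
lemma isTree_iff_comap_castSucc_of_subdivision (K : SimpleGraph (Fin (n + 1))) {a b : Fin n}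
    (hab : a ≠ b) (hK : ∀ x : Fin n, K.Adj x.castSucc (Fin.last n) ↔ x = a ∨ x = b)
    (hnadj : ¬ K.Adj a.castSucc b.castSucc) :
    K.IsTree ↔ (K.comap Fin.castSucc ⊔ edge a b).IsTree := by
  have hpair : {x : Fin n | K.Adj x.castSucc (Fin.last n)} = {a, b} := by
    ext x
    exact hK x
  rw [isTree_iff_connected_and_card, isTree_iff_connected_and_card, Nat.card_coe_set_eq,
    Nat.card_coe_set_eq, ncard_edgeSet_eq_comap_castSucc_add, hpair, Set.ncard_pair hab,
    ncard_edgeSet_sup_edge _ hab (by simpa using hnadj)]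
  simp only [Nat.card_eq_fintype_card, Fintype.card_fin]
  refine and_congr ⟨fun h => ?_, fun h => ?_⟩ (by omega)
  · have hba : (K.comap Fin.castSucc ⊔ edge a b).Reachable b a :=
      Adj.reachable (Or.inr (by simp [edge_adj, hab.symm]))
    refine h.of_surjective_of_adj_reachable (Fin.lastCases a id)
      (fun x => ⟨x.castSucc, by simp⟩) fun x y hxy => ?_
    induction x using Fin.lastCases with
    | last =>
      induction y using Fin.lastCases with
      | last => simp
      | cast y =>
        rcases (hK y).1 hxy.symm with rfl | rfl
        · simp
        · simpa using hba.symm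
    | cast x =>
      induction y using Fin.lastCases with
      | last =>
        rcases (hK x).1 hxy with rfl | rfl
        · simp
        · simpa using hba
      | cast y =>
        simpa using Adj.reachable (G := K.comap Fin.castSucc ⊔ edge a b) (Or.inl hxy)
  · have hala : K.Reachable a.castSucc (Fin.last n) := ((hK a).2 (Or.inl rfl)).reachable
    have hbla : K.Reachable b.castSucc (Fin.last n) := ((hK b).2 (Or.inr rfl)).reachable
    have hadj (x y : Fin n) (hxy : (K.comap Fin.castSucc ⊔ edge a b).Adj x y) :
        K.Reachable x.castSucc y.castSucc := by
      rcases hxy with hxy | hxy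
      · exact Adj.reachable hxy
      · rw [edge_adj] at hxy
        rcases hxy.1 with ⟨rfl, rfl⟩ | ⟨rfl, rfl⟩
        · exact hala.trans hbla.symm
        · exact hbla.trans hala.symm
    have hcast (x y : Fin n) : K.Reachable x.castSucc y.castSucc := by
      obtain ⟨p⟩ := h.preconnected x y
      induction p with
      | nil => rfl
      | cons hxy _ ih => exact (hadj _ _ hxy).trans ih
    refine (connected_iff_exists_forall_reachable K).2 ⟨a.castSucc, fun x => ?_⟩
    induction x using Fin.lastCases with
    | last => exact hala
    | cast x => exact hcast a x

lemma IsAcyclic.not_adj_of_adj_of_adj {G : SimpleGraph V} (hG : G.IsAcyclic) {a b c : V}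
    (hab : G.Adj a c) (hbc : G.Adj b c) : ¬ G.Adj a b := by
  classical
  intro h
  exact hG.cliqueFree le_rfl {a, b, c} (is3Clique_triple_iff.2 ⟨h, hab, hbc⟩)

end SimpleGraph

open SimpleGraph

lemma fanGraph_adj {n : ℕ} (i j : Fin (n + 1)) : (fanGraph n).Adj i j ↔
    i ≠ j ∧ ((i = 0 ∨ (i : ℕ) + 1 = j) ∨ (j = 0 ∨ (j : ℕ) + 1 = i)) := by
  simp [fanGraph]

lemma fanGraph_adj_zero_last {n : ℕ} (hn : n ≠ 0) : (fanGraph n).Adj 0 (Fin.last n) :=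
  (fanGraph_adj _ _).2 ⟨by simp [Fin.ext_iff, hn.symm], Or.inl (Or.inl rfl)⟩

lemma le_fanGraph_succ_iff {n : ℕ} (K : SimpleGraph (Fin (n + 2))) :
    K ≤ fanGraph (n + 1) ↔ K.comap Fin.castSucc ≤ fanGraph n ∧
      ∀ x : Fin (n + 1), K.Adj x.castSucc (Fin.last (n + 1)) → x = 0 ∨ x = Fin.last n := by
  have hcast (x y : Fin (n + 1)) :
      (fanGraph (n + 1)).Adj x.castSucc y.castSucc ↔ (fanGraph n).Adj x y := by
    simp only [fanGraph_adj, Fin.ext_iff, ne_eq, Fin.val_castSucc, Fin.val_zero]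
  have hlast (x : Fin (n + 1)) :
      (fanGraph (n + 1)).Adj x.castSucc (Fin.last (n + 1)) ↔ x = 0 ∨ x = Fin.last n := by
    simp only [fanGraph_adj, Fin.ext_iff, ne_eq, Fin.val_castSucc, Fin.val_last, Fin.val_zero]
    omega
  refine ⟨fun h => ⟨fun x y hxy => (hcast x y).1 (h hxy), fun x hx => (hlast x).1 (h hx)⟩,
    fun ⟨h₁, h₂⟩ x y hxy => ?_⟩
  induction x using Fin.lastCases with
  | last =>
    induction y using Fin.lastCases with
    | last => simp at hxy
    | cast y => exact ((hlast y).2 (h₂ y hxy.symm)).symm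
  | cast x =>
    induction y using Fin.lastCases with
    | last => exact (hlast x).2 (h₂ x hxy)
    | cast y => exact (hcast x y).2 (h₁ hxy)

/-- The spanning trees of the fan graph. -/
def fanTrees (n : ℕ) : Set (SimpleGraph (Fin (n + 1))) :=
  {H | H ≤ fanGraph n ∧ H.IsTree}

lemma spanningTreeCount_fanGraph (n : ℕ) :
    spanningTreeCount (fanGraph n) = (fanTrees n).ncard :=
  Nat.card_coe_set_eq (fanTrees n)

/-- Spanning trees of a fan in which the last path vertex is a leaf attached to `a` correspond to
spanning trees of the smaller fan. -/
lemma ncard_fanTrees_leaf {n : ℕ} (a : Fin (n + 1)) (ha : a = 0 ∨ a = Fin.last n) :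
    {K ∈ fanTrees (n + 1) | ∀ x : Fin (n + 1),
      K.Adj x.castSucc (Fin.last (n + 1)) ↔ x = a}.ncard = (fanTrees n).ncard := by
  refine Set.BijOn.ncard_eq (f := SimpleGraph.comap Fin.castSucc) ⟨?_, ?_, ?_⟩
  · rintro K ⟨⟨hle, hK⟩, hadj⟩
    exact ⟨((le_fanGraph_succ_iff K).1 hle).1, (isTree_iff_comap_castSucc_of_leaf K a hadj).1 hK⟩
  · rintro K ⟨-, hadj⟩ K' ⟨-, hadj'⟩ h
    exact ext_castSucc h fun x => (hadj x).trans (hadj' x).symm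
  · rintro H ⟨hle, hH⟩
    obtain ⟨K, rfl, hadj⟩ := exists_comap_castSucc_eq H {a}
    refine ⟨K, ⟨⟨(le_fanGraph_succ_iff K).2 ⟨hle, fun x hx => ?_⟩,
      (isTree_iff_comap_castSucc_of_leaf K a hadj).2 hH⟩, hadj⟩, rfl⟩
    obtain rfl : x = a := (hadj x).1 hx
    exact ha

/-- Spanning trees of a fan in which the last path vertex is joined both to the hub and to its
predecessor correspond, by contracting the last path edge, to spanning trees of the smaller fan
using its last hub edge. -/
lemma ncard_fanTrees_both {n : ℕ} (hn : n ≠ 0) :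
    {K ∈ fanTrees (n + 1) | ∀ x : Fin (n + 1),
      K.Adj x.castSucc (Fin.last (n + 1)) ↔ x = 0 ∨ x = Fin.last n}.ncard =
      {H ∈ fanTrees n | H.Adj 0 (Fin.last n)}.ncard := by
  have h0 : (0 : Fin (n + 1)) ≠ Fin.last n := by simp [Fin.ext_iff, hn.symm]
  have hnadj {K : SimpleGraph (Fin (n + 2))} (hK : K.IsTree) (hadj : ∀ x : Fin (n + 1),
      K.Adj x.castSucc (Fin.last (n + 1)) ↔ x = 0 ∨ x = Fin.last n) :
      ¬ K.Adj (Fin.castSucc 0) (Fin.last n).castSucc :=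
    hK.isAcyclic.not_adj_of_adj_of_adj ((hadj _).2 (Or.inl rfl)) ((hadj _).2 (Or.inr rfl))
  have hedge : edge 0 (Fin.last n) ≤ fanGraph n :=
    (edge_le_iff (fanGraph n)).2 (Or.inr (fanGraph_adj_zero_last hn))
  refine Set.BijOn.ncard_eq
    (f := fun K => K.comap Fin.castSucc ⊔ edge 0 (Fin.last n)) ⟨?_, ?_, ?_⟩
  · rintro K ⟨⟨hle, hK⟩, hadj⟩
    exact ⟨⟨sup_le ((le_fanGraph_succ_iff K).1 hle).1 hedge,
      (isTree_iff_comap_castSucc_of_subdivision K h0 hadj (hnadj hK hadj)).1 hK⟩,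
      Or.inr (by simp [edge_adj, h0])⟩
  · rintro K ⟨⟨-, hK⟩, hadj⟩ K' ⟨⟨-, hK'⟩, hadj'⟩ h
    refine ext_castSucc ?_ fun x => (hadj x).trans (hadj' x).symm
    have hsdiff {K : SimpleGraph (Fin (n + 2))}
        (h : ¬ K.Adj (Fin.castSucc 0) (Fin.last n).castSucc) :
        (K.comap Fin.castSucc ⊔ edge 0 (Fin.last n)) \ edge 0 (Fin.last n) =
          K.comap Fin.castSucc := by
      rw [sup_sdiff_right_self, sdiff_eq_left, disjoint_edge]
      exact h
    rw [← hsdiff (hnadj hK hadj), ← hsdiff (hnadj hK' hadj')]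
    exact congrArg (· \ edge 0 (Fin.last n)) h
  · rintro H ⟨⟨hle, hH⟩, hadj⟩
    obtain ⟨K, hKH, hK⟩ := exists_comap_castSucc_eq (H \ edge 0 (Fin.last n)) {0, Fin.last n}
    have hsup : K.comap Fin.castSucc ⊔ edge 0 (Fin.last n) = H := by
      rw [hKH, sdiff_sup_cancel]
      exact (edge_le_iff H).2 (Or.inr hadj)
    have hnot : ¬ K.Adj (Fin.castSucc 0) (Fin.last n).castSucc := by
      rw [← SimpleGraph.comap_adj, hKH]
      simp [edge_adj, h0]
    refine ⟨K, ⟨⟨(le_fanGraph_succ_iff K).2 ⟨?_, fun x hx => (hK x).1 hx⟩, ?_⟩, hK⟩, hsup⟩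
    · rw [hKH]
      exact sdiff_le.trans hle
    · rw [isTree_iff_comap_castSucc_of_subdivision K h0 hK hnot, hsup]
      exact hH

lemma exists_adj_last_of_mem_fanTrees {n : ℕ} {K : SimpleGraph (Fin (n + 2))}
    (hK : K ∈ fanTrees (n + 1)) : K.Adj (Fin.castSucc 0) (Fin.last (n + 1)) ∨
      K.Adj (Fin.last n).castSucc (Fin.last (n + 1)) := by
  obtain ⟨x, hx⟩ := hK.2.connected.preconnected.exists_adj_of_nontrivial (Fin.last (n + 1))
  induction x using Fin.lastCases with
  | last => simp at hx
  | cast x =>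
    rcases ((le_fanGraph_succ_iff K).1 hK.1).2 x hx.symm with rfl | rfl
    · exact Or.inl hx.symm
    · exact Or.inr hx.symm

lemma ncard_fanTrees_succ {n : ℕ} (hn : n ≠ 0) :
    (fanTrees (n + 1)).ncard = (fanTrees n).ncard +
      {K ∈ fanTrees (n + 1) | K.Adj 0 (Fin.last (n + 1))}.ncard := by
  have h0 : (0 : Fin (n + 1)) ≠ Fin.last n := by simp [Fin.ext_iff, hn.symm]
  rw [← ncard_fanTrees_leaf (Fin.last n) (Or.inr rfl), ← Set.ncard_union_eq]
  · congr 1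
    ext K
    refine ⟨fun hK => ?_, fun h => h.elim And.left And.left⟩
    by_cases hadj : K.Adj 0 (Fin.last (n + 1))
    · exact Or.inr ⟨hK, hadj⟩
    · refine Or.inl ⟨hK, fun x => ⟨fun hx => ?_, ?_⟩⟩
      · rcases ((le_fanGraph_succ_iff K).1 hK.1).2 x hx with rfl | rfl
        · exact absurd hx hadj
        · rfl
      · rintro rfl
        exact (exists_adj_last_of_mem_fanTrees hK).resolve_left hadj
  · rw [Set.disjoint_left]
    rintro K ⟨-, h⟩ ⟨-, hadj⟩
    exact h0 ((h 0).1 hadj)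

lemma ncard_fanTrees_succ_adj_zero_last {n : ℕ} (hn : n ≠ 0) :
    {K ∈ fanTrees (n + 1) | K.Adj 0 (Fin.last (n + 1))}.ncard = (fanTrees n).ncard +
      {H ∈ fanTrees n | H.Adj 0 (Fin.last n)}.ncard := by
  have h0 : (0 : Fin (n + 1)) ≠ Fin.last n := by simp [Fin.ext_iff, hn.symm]
  rw [← ncard_fanTrees_leaf 0 (Or.inl rfl), ← ncard_fanTrees_both hn, ← Set.ncard_union_eq]
  · congr 1
    ext K
    constructor
    · rintro ⟨hK, hadj⟩
      have hsub := ((le_fanGraph_succ_iff K).1 hK.1).2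
      by_cases hlast : K.Adj (Fin.last n).castSucc (Fin.last (n + 1))
      · refine Or.inr ⟨hK, fun x => ⟨hsub x, ?_⟩⟩
        rintro (rfl | rfl)
        · exact hadj
        · exact hlast
      · refine Or.inl ⟨hK, fun x => ⟨fun hx => ?_, ?_⟩⟩
        · rcases hsub x hx with rfl | rfl
          · rfl
          · exact absurd hx hlast
        · rintro rfl
          exact hadj
    · rintro (⟨hK, h⟩ | ⟨hK, h⟩)
      · exact ⟨hK, (h 0).2 rfl⟩
      · exact ⟨hK, (h 0).2 (Or.inl rfl)⟩
  · rw [Set.disjoint_left]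
    rintro K ⟨-, h⟩ ⟨-, h'⟩
    exact h0 ((h _).1 ((h' (Fin.last n)).2 (Or.inr rfl))).symm

/-- The numbers `aₙ` of spanning trees of fans satisfy `a_{n+1} = 3 aₙ − a_{n−1}`. -/
theorem spanningTreeCount_fanGraph_recurrence (n : ℕ) (hn : 2 ≤ n) :
    (spanningTreeCount (fanGraph (n + 1)) : ℤ) =
      3 * spanningTreeCount (fanGraph n) - spanningTreeCount (fanGraph (n - 1)) := by
  obtain ⟨m, rfl⟩ : ∃ m, n = m + 1 := ⟨n - 1, by omega⟩
  have h₁ := ncard_fanTrees_succ (n := m) (by omega)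
  have h₂ := ncard_fanTrees_succ (n := m + 1) (by omega)
  have h₃ := ncard_fanTrees_succ_adj_zero_last (n := m + 1) (by omega)
  have h₄ : spanningTreeCount (fanGraph (m + 1 - 1)) = (fanTrees m).ncard :=
    spanningTreeCount_fanGraph m
  rw [h₄, spanningTreeCount_fanGraph, spanningTreeCount_fanGraph]
  omega
end

section
/- Let cₙ and aₙ denote the numbers of spanning trees of the wheel graph Φₙ and the fan graph Θₙ respectively. Then for every n ≥ 3, c_{n+1} − a_{n+1} = cₙ + aₙ. -/
/-- The wheel graph `Φₙ`: the fan `Θₙ` together with the edge from `n` back to `1`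
closing the path into a cycle. -/
def wheelGraph (n : ℕ) : SimpleGraph (Fin (n + 1)) :=
  SimpleGraph.fromRel
    (fun i j => i = 0 ∨ (i : ℕ) + 1 = (j : ℕ) ∨ ((i : ℕ) = n ∧ (j : ℕ) = 1))

namespace SimpleGraph

variable {V : Type*}

/-- A parent map for `G` rooted at `r`: every vertex other than `r` is sent to a neighbour,
and iterating the map leads every vertex to `r`. -/
structure IsParentMap (G : SimpleGraph V) (r : V) (f : V → V) : Prop where
  map_root : f r = r
  adj : ∀ v ≠ r, G.Adj v (f v)
  exists_iterate : ∀ v, ∃ k, f^[k] v = r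

/-- The graph joining every vertex to its image under `f`. -/
def ofParentMap (f : V → V) : SimpleGraph V :=
  fromRel fun v w => f v = w

lemma ofParentMap_adj {f : V → V} {v w : V} :
    (ofParentMap f).Adj v w ↔ v ≠ w ∧ (f v = w ∨ f w = v) := by
  simp [ofParentMap]

namespace IsParentMap

variable {G : SimpleGraph V} {r : V} {f g : V → V}

/-- A set avoiding the root and closed under a parent map is empty. -/
lemma notMem_of_mapsTo (hf : G.IsParentMap r f) {S : Set V} (hS : Set.MapsTo f S S)
    (hr : r ∉ S) (v : V) : v ∉ S := by
  intro hv
  obtain ⟨k, hk⟩ := hf.exists_iterate v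
  exact hr (hk ▸ hS.iterate k hv)

lemma ofParentMap_le (hf : G.IsParentMap r f) : ofParentMap f ≤ G := by
  have key : ∀ v w, v ≠ w → f v = w → G.Adj v w := by
    rintro v _ hne rfl
    refine hf.adj v ?_
    rintro rfl
    exact hne hf.map_root.symm
  intro v w h
  rw [ofParentMap_adj] at h
  obtain ⟨hne, h | h⟩ := h
  · exact key v w hne h
  · exact (key w v hne.symm h).symm

lemma connected_ofParentMap (hf : G.IsParentMap r f) : (ofParentMap f).Connected := by
  have step : ∀ v, (ofParentMap f).Reachable v (f v) := by
    intro v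
    by_cases h : v = f v
    · rw [← h]
    · exact (ofParentMap_adj.2 ⟨h, Or.inl rfl⟩).reachable
  have iter : ∀ k v, (ofParentMap f).Reachable v (f^[k] v) := by
    intro k
    induction k with
    | zero => exact fun v => Reachable.refl v
    | succ k ih => exact fun v => (step v).trans (ih (f v))
  have root : ∀ v, (ofParentMap f).Reachable v r := by
    intro v
    obtain ⟨k, hk⟩ := hf.exists_iterate v
    exact hk ▸ iter k v
  exact { preconnected := fun v w => (root v).trans (root w).symm, nonempty := ⟨r⟩ }

lemma isTree_ofParentMap [Finite V] (hf : G.IsParentMap r f) : (ofParentMap f).IsTree := by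
  have hc := hf.connected_ofParentMap
  refine isTree_iff_connected_and_card.2 ⟨hc, le_antisymm ?_ hc.card_vert_le_card_edgeSet_add_one⟩
  have hsub : (ofParentMap f).edgeSet ⊆ Set.image (fun v => s(v, f v)) {r}ᶜ := by
    intro e
    induction e with
    | h v w =>
      rw [mem_edgeSet, ofParentMap_adj]
      rintro ⟨hne, rfl | rfl⟩
      · exact ⟨v, fun h => hne (by rw [Set.mem_singleton_iff.1 h, hf.map_root]), rfl⟩
      · exact ⟨w, fun h => hne (by rw [Set.mem_singleton_iff.1 h, hf.map_root]), Sym2.eq_swap⟩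
  have h1 := (Set.ncard_le_ncard hsub).trans (Set.ncard_image_le (Set.toFinite _))
  rw [← Set.ncard_add_ncard_compl {r}, Set.ncard_singleton, Nat.card_coe_set_eq]
  omega

lemma map_map_ne (hf : G.IsParentMap r f) {v : V} (hv : v ≠ r) : f (f v) ≠ v := by
  intro h
  by_cases hr : f v = r
  · exact hv (by rw [← h, hr, hf.map_root])
  refine hf.notMem_of_mapsTo (S := {v, f v}) ?_ ?_ v (by simp)
  · rintro _ (rfl | rfl) <;> simp [h]
  · simp [hv.symm, Ne.symm hr]

/-- A parent map is determined by its graph: following `f` from a vertex where `f` and `g`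
differ, `g` would have to undo every step, so that `f` could never arrive at the root. -/
lemma ext_of_ofParentMap_eq (hf : G.IsParentMap r f) (hg : G.IsParentMap r g)
    (h : ofParentMap f = ofParentMap g) : f = g := by
  have key : ∀ v ≠ r, g v = f v ∨ g (f v) = v := by
    intro v hv
    have : (ofParentMap g).Adj v (f v) :=
      h ▸ ofParentMap_adj.2 ⟨(hf.adj v hv).ne, Or.inl rfl⟩
    exact (ofParentMap_adj.1 this).2
  funext v
  by_contra hne
  refine hf.notMem_of_mapsTo (S := {u | u ≠ r ∧ f u ≠ g u}) ?_ (by simp) v ⟨?_, hne⟩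
  · rintro u ⟨hu, hfg⟩
    have hgu : g (f u) = u := (key u hu).resolve_left (Ne.symm hfg)
    refine ⟨fun hr => hu ?_, ?_⟩
    · rw [← hgu, hr, hg.map_root]
    · rw [hgu]
      exact hf.map_map_ne hu
  · rintro rfl
    exact hne (hf.map_root.trans hg.map_root.symm)

end IsParentMap

/-- Every connected graph has a parent map, which moves towards the root. -/
lemma Connected.exists_isParentMap {G : SimpleGraph V} (hG : G.Connected) (r : V) :
    ∃ f, G.IsParentMap r f := by
  have step : ∀ v, ∃ w, (v = r → w = r) ∧ (v ≠ r → G.Adj v w ∧ G.dist w r < G.dist v r) := by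
    intro v
    by_cases hv : v = r
    · exact ⟨r, fun _ => rfl, fun h => absurd hv h⟩
    obtain ⟨p, hp⟩ := hG.exists_walk_length_eq_dist v r
    cases p with
    | nil => exact absurd rfl hv
    | @cons _ w _ hadj q =>
      refine ⟨w, fun h => absurd h hv, fun _ => ⟨hadj, ?_⟩⟩
      have := dist_le q
      rw [Walk.length_cons] at hp
      omega
  choose f hroot hstep using step
  refine ⟨f, hroot r rfl, fun v hv => (hstep v hv).1, ?_⟩
  intro v
  induction hd : G.dist v r using Nat.strong_induction_on generalizing v with
  | _ d ih =>
    by_cases hv : v = r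
    · exact ⟨0, hv⟩
    · obtain ⟨k, hk⟩ := ih _ (hd ▸ (hstep v hv).2) (f v) rfl
      exact ⟨k + 1, hk⟩

end SimpleGraph

open SimpleGraph in
/-- Spanning trees correspond to parent maps towards any fixed root. -/
lemma spanningTreeCount_eq_card_isParentMap {V : Type*} [Finite V] (G : SimpleGraph V) (r : V) :
    spanningTreeCount G = Nat.card {f : V → V // G.IsParentMap r f} := by
  symm
  refine Nat.card_congr (Equiv.ofBijective
    (fun f => ⟨ofParentMap f.1, f.2.ofParentMap_le, f.2.isTree_ofParentMap⟩) ⟨?_, ?_⟩)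
  · intro f g h
    exact Subtype.ext (f.2.ext_of_ofParentMap_eq g.2 (congrArg Subtype.val h))
  · rintro ⟨H, hle, hH⟩
    obtain ⟨f, hf⟩ := hH.connected.exists_isParentMap r
    refine ⟨⟨f, hf.map_root, fun v hv => hle (hf.adj v hv), hf.exists_iterate⟩, Subtype.ext ?_⟩
    exact le_antisymm hf.ofParentMap_le
      ((isTree_iff_minimal_connected.1 hH).2 hf.connected_ofParentMap hf.ofParentMap_le)

open Matrix Finset in
/-- The transfer-matrix method: summing the weights of all words of length `k + 1`, together with
a weight depending on the two end letters, amounts to computing the `k`-th power of the matrix. -/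
lemma sum_prod_eq_sum_mul_pow {α R : Type*} [Fintype α] [DecidableEq α] [CommSemiring R]
    (M : Matrix α α R) (k : ℕ) (g : α → α → R) :
    ∑ w : Fin (k + 1) → α,
        g (w 0) (w (Fin.last k)) * ∏ i : Fin k, M (w i.castSucc) (w i.succ) =
      ∑ a, ∑ b, g a b * (M ^ k) a b := by
  induction k generalizing g with
  | zero =>
    rw [← (Equiv.funUnique (Fin 1) α).symm.sum_comp]
    simp [Matrix.one_apply]
  | succ k ih =>
    rw [← (Fin.consEquiv fun _ => α).sum_comp, Fintype.sum_prod_type]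
    refine sum_congr rfl fun a _ => ?_
    have := ih fun x b => g a b * M a x
    simp only [Fin.consEquiv, Equiv.coe_fn_mk, Fin.prod_univ_succ, Fin.castSucc_zero, Fin.cons_zero,
      Fin.cons_succ, ← Fin.succ_last, ← Fin.succ_castSucc]
    simp only [mul_assoc] at this
    rw [this, sum_comm]
    refine sum_congr rfl fun b _ => ?_
    rw [pow_succ', Matrix.mul_apply, mul_sum]

/-- The three neighbours of the rim vertex `i + 1` of a wheel: the hub, the previous and the
next rim vertex. -/
def wheelStep {k : ℕ} (i : Fin (k + 1)) : Fin 3 → Fin (k + 2) :=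
  ![0, (i - 1).succ, (i + 1).succ]

/-- The self-map of the vertices of a wheel that fixes the hub and moves every rim vertex in
the direction prescribed by a word. -/
def wheelMap {k : ℕ} (w : Fin (k + 1) → Fin 3) : Fin (k + 2) → Fin (k + 2) :=
  Fin.cons 0 fun i => wheelStep i (w i)

section Wheel

variable {k : ℕ}

@[simp]
lemma wheelStep_zero (i : Fin (k + 1)) : wheelStep i 0 = 0 := rfl

@[simp]
lemma wheelStep_one (i : Fin (k + 1)) : wheelStep i 1 = (i - 1).succ := rfl

@[simp]
lemma wheelStep_two (i : Fin (k + 1)) : wheelStep i 2 = (i + 1).succ := rfl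

@[simp]
lemma wheelMap_zero (w : Fin (k + 1) → Fin 3) : wheelMap w 0 = 0 := rfl

@[simp]
lemma wheelMap_succ (w : Fin (k + 1) → Fin 3) (i : Fin (k + 1)) :
    wheelMap w i.succ = wheelStep i (w i) := rfl

lemma Fin.add_one_ne_sub_one (hk : 2 ≤ k) (i : Fin (k + 1)) : i + 1 ≠ i - 1 := by
  intro h
  have hi : i + 1 + 1 = i := eq_sub_iff_add_eq.1 h
  have := congrArg Fin.val hi
  simp only [Fin.val_add_one, Fin.ext_iff, Fin.val_last] at this
  split_ifs at this <;> omega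

lemma wheelStep_injective (hk : 2 ≤ k) (i : Fin (k + 1)) :
    Function.Injective (wheelStep i) := by
  have := Fin.add_one_ne_sub_one hk i
  intro a b
  fin_cases a <;> fin_cases b <;>
    simp [this, this.symm, Fin.succ_ne_zero, (Fin.succ_ne_zero _).symm]

lemma wheelGraph_adj_succ_iff (hk : 2 ≤ k) (i : Fin (k + 1)) (x : Fin (k + 2)) :
    (wheelGraph (k + 1)).Adj i.succ x ↔ ∃ c, wheelStep i c = x := by
  have hex : (∃ c, wheelStep i c = x) ↔ x = 0 ∨ x = (i - 1).succ ∨ x = (i + 1).succ := by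
    simp [Fin.exists_fin_succ, eq_comm]
  rw [hex]
  cases x using Fin.cases with
  | zero => simp [wheelGraph]
  | succ j =>
    rw [Fin.succ_inj, Fin.succ_inj, eq_sub_iff_add_eq]
    simp only [wheelGraph, SimpleGraph.fromRel_adj, Fin.ext_iff, Fin.val_add_one, Fin.val_last,
      Fin.val_succ, Fin.coe_ofNat_eq_mod, Nat.zero_mod, ne_eq]
    split_ifs <;> grind

lemma fanGraph_adj_wheelStep_iff (hk : 2 ≤ k) (i : Fin (k + 1)) (c : Fin 3) :
    (fanGraph (k + 1)).Adj i.succ (wheelStep i c) ↔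
      ¬(i = 0 ∧ c = 1) ∧ ¬(i = Fin.last k ∧ c = 2) := by
  have hc : c = 0 ∨ c = 1 ∨ c = 2 := by omega
  rcases hc with rfl | rfl | rfl
  · simp [fanGraph]
  · obtain ⟨j, rfl⟩ : ∃ j, i = j + 1 := ⟨i - 1, (sub_add_cancel i 1).symm⟩
    simp only [show (1 : Fin 3) ≠ 2 by decide, eq_self, and_true, and_false, not_false_eq_true]
    simp only [wheelStep_one, add_sub_cancel_right, fanGraph, SimpleGraph.fromRel_adj, Fin.ext_iff,
      Fin.val_add_one, Fin.val_last, Fin.val_succ, Fin.coe_ofNat_eq_mod, Nat.zero_mod, ne_eq]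
    split_ifs <;> grind
  · simp only [show (2 : Fin 3) ≠ 1 by decide, eq_self, and_true, and_false, not_false_eq_true,
      true_and]
    simp only [wheelStep_two, fanGraph, SimpleGraph.fromRel_adj, Fin.ext_iff,
      Fin.val_add_one, Fin.val_last, Fin.val_succ, Fin.coe_ofNat_eq_mod, Nat.zero_mod, ne_eq]
    split_ifs <;> grind

lemma fanGraph_le_wheelGraph (n : ℕ) : fanGraph n ≤ wheelGraph n := by
  intro i j
  simp only [fanGraph, wheelGraph, SimpleGraph.fromRel_adj]
  tauto

open Fin.CommRing in
/-- A word describes a parent map towards the hub of a wheel iff nowhere a step forward is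
followed by a step back, and the steps do not all lead the same way around the rim. -/
lemma isParentMap_wheelMap_iff {G : SimpleGraph (Fin (k + 2))}
    (w : Fin (k + 1) → Fin 3) :
    G.IsParentMap 0 (wheelMap w) ↔ (∀ i, G.Adj i.succ (wheelStep i (w i))) ∧
      (∀ i, ¬(w i = 2 ∧ w (i + 1) = 1)) ∧ w ≠ (fun _ => 1) ∧ w ≠ fun _ => 2 := by
  constructor
  · intro h
    refine ⟨fun i => h.adj i.succ i.succ_ne_zero, ?_, ?_, ?_⟩
    · rintro i ⟨h2, h1⟩
      exact h.map_map_ne i.succ_ne_zero (by simp [h1, h2])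
    · rintro rfl
      refine h.notMem_of_mapsTo (S := {0}ᶜ) ?_ (by simp) (Fin.succ 0) (by simp)
      intro v hv
      obtain ⟨i, rfl⟩ := Fin.exists_succ_eq.2 hv
      simp
    · rintro rfl
      refine h.notMem_of_mapsTo (S := {0}ᶜ) ?_ (by simp) (Fin.succ 0) (by simp)
      intro v hv
      obtain ⟨i, rfl⟩ := Fin.exists_succ_eq.2 hv
      simp
  · rintro ⟨hadj, hRL, hL, hR⟩
    refine ⟨rfl, fun v hv => ?_, ?_⟩
    · obtain ⟨i, rfl⟩ := Fin.exists_succ_eq.2 hv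
      exact hadj i
    by_contra! hbad
    obtain ⟨v, hv⟩ := hbad
    have hv0 : v ≠ 0 := hv 0
    obtain ⟨i, rfl⟩ := Fin.exists_succ_eq.2 hv0
    set B : Set (Fin (k + 1)) := {j | ∀ m, (wheelMap w)^[m] j.succ ≠ 0} with hB
    have hnot : ∀ j ∈ B, w j ≠ 0 := fun j hj h0 => hj 1 (by simp [h0])
    have hback : ∀ j ∈ B, w j = 1 → j - 1 ∈ B := fun j hj h1 m => by
      simpa [Function.iterate_succ_apply, h1] using hj (m + 1)
    have hforth : ∀ j ∈ B, w j = 2 → j + 1 ∈ B := fun j hj h2 m => by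
      simpa [Function.iterate_succ_apply, h2] using hj (m + 1)
    have h3 : ∀ c : Fin 3, c ≠ 0 → c = 1 ∨ c = 2 := by decide
    rcases h3 _ (hnot i hv) with h1 | h2
    · have key : ∀ m : ℕ, i - (m : Fin (k + 1)) ∈ B ∧ w (i - (m : Fin (k + 1))) = 1 := by
        intro m
        induction m with
        | zero => simpa using ⟨hv, h1⟩
        | succ m ih =>
          have hmem := hback _ ih.1 ih.2
          push_cast
          rw [← sub_sub]
          refine ⟨hmem, (h3 _ (hnot _ hmem)).resolve_right fun h => hRL _ ⟨h, ?_⟩⟩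
          rw [sub_add_cancel]
          exact ih.2
      refine hL (funext fun j => ?_)
      simpa using (key (i - j).val).2
    · have key : ∀ m : ℕ, i + (m : Fin (k + 1)) ∈ B ∧ w (i + (m : Fin (k + 1))) = 2 := by
        intro m
        induction m with
        | zero => simpa using ⟨hv, h2⟩
        | succ m ih =>
          have hmem := hforth _ ih.1 ih.2
          push_cast
          rw [← add_assoc]
          exact ⟨hmem, (h3 _ (hnot _ hmem)).resolve_left fun h => hRL _ ⟨ih.2, h⟩⟩
      refine hR (funext fun j => ?_)
      simpa using (key (j - i).val).2

lemma spanningTreeCount_eq_card_words (hk : 2 ≤ k) {G : SimpleGraph (Fin (k + 2))}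
    (hG : G ≤ wheelGraph (k + 1)) :
    spanningTreeCount G = Nat.card {w : Fin (k + 1) → Fin 3 //
      (∀ i, G.Adj i.succ (wheelStep i (w i))) ∧
      (∀ i, ¬(w i = 2 ∧ w (i + 1) = 1)) ∧ w ≠ (fun _ => 1) ∧ w ≠ fun _ => 2} := by
  rw [spanningTreeCount_eq_card_isParentMap G 0]
  symm
  refine Nat.card_congr (Equiv.ofBijective
    (fun w => ⟨wheelMap w.1, (isParentMap_wheelMap_iff w.1).2 w.2⟩) ⟨?_, ?_⟩)
  · intro w w' h
    refine Subtype.ext (funext fun i => wheelStep_injective hk i ?_)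
    exact congrFun (congrArg Subtype.val h) i.succ
  · rintro ⟨f, hf⟩
    choose w hw using fun i : Fin (k + 1) =>
      (wheelGraph_adj_succ_iff hk i _).1 (hG (hf.adj i.succ i.succ_ne_zero))
    have hwf : wheelMap w = f := by
      funext v
      cases v using Fin.cases with
      | zero => exact hf.map_root.symm
      | succ i => exact hw i
    subst hwf
    exact ⟨⟨w, (isParentMap_wheelMap_iff w).1 hf⟩, rfl⟩

end Wheel

/-- The transfer matrix of the words over `{0, 1, 2}` in which `2` is never followed by `1`. -/
def wheelTransfer : Matrix (Fin 3) (Fin 3) ℤ :=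
  .of fun a b => if a = 2 ∧ b = 1 then 0 else 1

open Finset in
lemma sum_cyclic_words (k : ℕ) (g : Fin 3 → Fin 3 → ℤ) :
    ∑ w : Fin (k + 1) → Fin 3 with ∀ i, ¬(w i = 2 ∧ w (i + 1) = 1), g (w 0) (w (Fin.last k)) =
      ∑ a, ∑ b, g a b * wheelTransfer b a * (wheelTransfer ^ k) a b := by
  rw [← sum_prod_eq_sum_mul_pow wheelTransfer k fun a b => g a b * wheelTransfer b a, sum_filter]
  refine sum_congr rfl fun w _ => ?_
  have h : (∏ i : Fin (k + 1), wheelTransfer (w i) (w (i + 1))) =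
      if ∀ i, ¬(w i = 2 ∧ w (i + 1) = 1) then 1 else 0 := by
    simp only [wheelTransfer, Matrix.of_apply]
    simp_rw [← ite_not (_ ∧ _), prod_ite_zero, prod_const_one, mem_univ, true_imp_iff]
  rw [Fin.prod_univ_castSucc] at h
  simp only [Fin.coeSucc_eq_succ, Fin.last_add_one] at h
  rw [mul_assoc, mul_comm (wheelTransfer _ _), h, mul_ite, mul_one, mul_zero]

open Finset Classical in
lemma spanningTreeCount_wheelGraph {k : ℕ} (hk : 2 ≤ k) :
    (spanningTreeCount (wheelGraph (k + 1)) : ℤ) =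
      ∑ a, ∑ b, wheelTransfer b a * (wheelTransfer ^ k) a b - 2 := by
  have hsum := sum_cyclic_words k fun _ _ => 1
  simp only [one_mul, sum_const, nsmul_eq_mul, mul_one] at hsum
  rw [spanningTreeCount_eq_card_words hk le_rfl, Nat.card_eq_fintype_card, Fintype.card_subtype,
    ← hsum, eq_sub_iff_add_eq]
  have hset : ({w | ∀ i, ¬(w i = 2 ∧ w (i + 1) = 1)} : Finset (Fin (k + 1) → Fin 3)) =
      insert (fun _ => 1) (insert (fun _ => 2) (univ.filter fun w =>
        (∀ i, (wheelGraph (k + 1)).Adj i.succ (wheelStep i (w i))) ∧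
        (∀ i, ¬(w i = 2 ∧ w (i + 1) = 1)) ∧ w ≠ (fun _ => 1) ∧ w ≠ fun _ => 2)) := by
    ext w
    have hadj : ∀ i, (wheelGraph (k + 1)).Adj i.succ (wheelStep i (w i)) :=
      fun i => (wheelGraph_adj_succ_iff hk i _).2 ⟨_, rfl⟩
    simp only [mem_insert, mem_filter, mem_univ, true_and]
    by_cases h1 : w = fun _ => 1
    · simp [h1]
    by_cases h2 : w = fun _ => 2
    · simp [h2]
    simp only [h1, h2, hadj, ne_eq, not_false_eq_true, and_true, false_or, implies_true, true_and]
  have h12 : (fun _ : Fin (k + 1) => (1 : Fin 3)) ≠ fun _ => 2 :=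
    fun h => absurd (congrFun h 0) (by decide)
  rw [hset, card_insert_of_notMem (by simp [h12]), card_insert_of_notMem (by simp)]
  push_cast
  ring

open Finset Classical in
lemma spanningTreeCount_fanGraph_s11 {k : ℕ} (hk : 2 ≤ k) :
    (spanningTreeCount (fanGraph (k + 1)) : ℤ) =
      ∑ a, ∑ b, (if a ≠ 1 ∧ b ≠ 2 then 1 else 0) * wheelTransfer b a *
        (wheelTransfer ^ k) a b := by
  rw [← sum_cyclic_words k fun a b => if a ≠ 1 ∧ b ≠ 2 then 1 else 0,
    spanningTreeCount_eq_card_words hk (fanGraph_le_wheelGraph _), Nat.card_eq_fintype_card,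
    Fintype.card_subtype, ← sum_filter, filter_filter, sum_const, nsmul_eq_mul, mul_one]
  congr 2
  ext w
  simp only [mem_filter, mem_univ, true_and, fanGraph_adj_wheelStep_iff hk]
  constructor
  · rintro ⟨hadj, hw, -, -⟩
    exact ⟨hw, fun h => (hadj 0).1 ⟨rfl, h⟩, fun h => (hadj _).2 ⟨rfl, h⟩⟩
  · rintro ⟨hw, h1, h2⟩
    refine ⟨fun i => ⟨?_, ?_⟩, hw, ?_, ?_⟩
    · rintro ⟨rfl, h⟩
      exact h1 h
    · rintro ⟨rfl, h⟩
      exact h2 h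
    · rintro rfl
      exact h1 rfl
    · rintro rfl
      exact h2 rfl

lemma wheelTransfer_pow_eq (k : ℕ) : ∃ p q : ℤ,
    wheelTransfer ^ (k + 1) = p • wheelTransfer + q • wheelTransfer ^ 2 := by
  have hcube : wheelTransfer ^ 3 = (3 : ℤ) • wheelTransfer ^ 2 - wheelTransfer := by decide
  induction k with
  | zero => exact ⟨1, 0, by simp⟩
  | succ k ih =>
    obtain ⟨p, q, h⟩ := ih
    refine ⟨-q, p + 3 * q, ?_⟩
    rw [pow_succ, h, add_mul, smul_mul_assoc, smul_mul_assoc, ← pow_succ, ← pow_two, hcube]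
    module

/-- With `cₙ = τ(Φₙ)` and `aₙ = τ(Θₙ)`, one has `c_{n+1} − a_{n+1} = cₙ + aₙ`. -/
theorem spanningTreeCount_wheel_sub_fan (n : ℕ) (hn : 3 ≤ n) :
    (spanningTreeCount (wheelGraph (n + 1)) : ℤ) - spanningTreeCount (fanGraph (n + 1)) =
      spanningTreeCount (wheelGraph n) + spanningTreeCount (fanGraph n) := by
  obtain ⟨k, rfl⟩ : ∃ k, n = k + 1 + 1 := ⟨n - 2, by omega⟩
  rw [spanningTreeCount_wheelGraph (by omega), spanningTreeCount_wheelGraph (by omega),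
    spanningTreeCount_fanGraph_s11 (by omega), spanningTreeCount_fanGraph_s11 (by omega)]
  obtain ⟨p, q, h⟩ := wheelTransfer_pow_eq k
  have hM : wheelTransfer = !![1, 1, 1; 1, 1, 1; 1, 0, 1] := by decide
  rw [pow_succ _ (k + 1), h, hM]
  simp [Fin.sum_univ_three, pow_two, Matrix.mul_apply]
  ring
end
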